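/- arXiv:2205.11017 — 2 statements merged into one kernel-verified Lean document; each statement's English description precedes it below -/
import Mathlib

section
/- Let n ≥ 2 and M = Mₙ the n-fuse function, with tᵢ defined by t₀(x)=1 and tᵢ(x) = M(x - t_{i-1}(x)). For every x ≥ 0 and 1 ≤ i ≤ n-1, tᵢ(x)/i ≥ t_{i+1}(x)/(i+1). -/
/-- Auxiliary values of the `n`-fuse function: `t₀(x) = 1`,
`t_{i+1}(x) = M(x - tᵢ(x))`. -/
def tfun (M : ℝ → ℝ) (x : ℝ) : ℕ → ℝ
  | 0 => 1
  | i + 1 => M (x - tfun M x i)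

def PropP (M : ℝ → ℝ) (x : ℝ) : Prop := ∀ d, 0 ≤ d → d < M x → M (x + d) = M x - d

lemma PropP.mono {M : ℝ → ℝ} (hpos : ∀ x : ℝ, 0 < M x) {x y : ℝ} (h : PropP M y) (hxy : y < x) :
    y + M y ≤ x + M x := by
  have hp := hpos x
  by_cases hc : x - y < M y
  · have := h (x - y) (by linarith) hc
    rw [add_sub_cancel] at this
    linarith
  · linarith

lemma tfun_pos {M : ℝ → ℝ} (hpos : ∀ x : ℝ, 0 < M x) (x : ℝ) (j : ℕ) : 0 < tfun M x j := by
  cases j with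
  | zero => simp [tfun]
  | succ k => exact hpos _

lemma key_le {n : ℕ} (hn : 2 ≤ n) {M : ℝ → ℝ}
    (heq : ∀ x : ℝ, 0 ≤ x → M x = tfun M x n / n)
    (hpos : ∀ x : ℝ, 0 < M x) {x : ℝ} (hx : 0 ≤ x) (hP : ∀ y < x, PropP M y)
    (j : ℕ) (hj : j ≤ n) : j * M x ≤ tfun M x j := by
  have hstep : ∀ k : ℕ, tfun M x (j + k) ≤ tfun M x j + k * M x := by
    intro k
    induction k with
    | zero => simp
    | succ k ih =>
      have h1 := tfun_pos hpos x (j + k)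
      have h2 := PropP.mono hpos (hP (x - tfun M x (j + k)) (by linarith))
        (by linarith : x - tfun M x (j + k) < x)
      have h3 : tfun M x (j + (k + 1)) = M (x - tfun M x (j + k)) := rfl
      rw [h3]
      push_cast
      linarith
  obtain ⟨k, rfl⟩ := Nat.exists_eq_add_of_le hj
  have h1 := hstep k
  have h0 : ((j + k : ℕ) : ℝ) ≠ 0 := by
    have : j + k ≠ 0 := by omega
    exact_mod_cast this
  have h2 := heq x hx
  rw [eq_div_iff h0] at h2
  push_cast at h2
  linarith

lemma step_P {n : ℕ} (hn : 2 ≤ n) {M : ℝ → ℝ}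
    (heq : ∀ x : ℝ, 0 ≤ x → M x = tfun M x n / n)
    (hpos : ∀ x : ℝ, 0 < M x) {x : ℝ} (hx : 0 ≤ x) (hP : ∀ y < x, PropP M y) : PropP M x := by
  intro d hd hdM
  have ht : ∀ j : ℕ, j ≤ n → tfun M (x + d) j = tfun M x j - j * d := by
    intro j
    induction j with
    | zero => intro _; simp [tfun]
    | succ j ih =>
      intro hj
      have h1 := tfun_pos hpos x j
      have h2 := key_le hn heq hpos hx hP (j + 1) hj
      have hj0 : (0 : ℝ) < ((j + 1 : ℕ) : ℝ) := by positivity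
      have h3 : ((j + 1 : ℕ) : ℝ) * d < tfun M x (j + 1) :=
        lt_of_lt_of_le (mul_lt_mul_of_pos_left hdM hj0) h2
      have h4 := hP (x - tfun M x j) (by linarith) (((j + 1 : ℕ) : ℝ) * d) (by positivity) h3
      change M (x + d - tfun M (x + d) j) = M (x - tfun M x j) - _
      rw [ih (by omega), ← h4]
      congr 1
      push_cast
      ring
  have h0 : (n : ℝ) ≠ 0 := by
    have : n ≠ 0 := by omega
    exact_mod_cast this
  rw [heq (x + d) (by linarith), ht n le_rfl, heq x hx]
  field_simp

lemma all_P {n : ℕ} (hn : 2 ≤ n) {M : ℝ → ℝ}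
    (hneg : ∀ x : ℝ, x < 0 → M x = -x)
    (heq : ∀ x : ℝ, 0 ≤ x → M x = tfun M x n / n)
    (hpos : ∀ x : ℝ, 0 < M x) (x : ℝ) : PropP M x := by
  by_contra hx
  have hbneg : ∀ y < 0, PropP M y := by
    intro y hy d hd hdM
    rw [hneg y hy] at hdM ⊢
    rw [hneg _ (by linarith)]
    ring
  let B : Set ℝ := {y | ¬ PropP M y}
  have hne : B.Nonempty := ⟨x, hx⟩
  have hlb : ∀ y ∈ B, (0 : ℝ) ≤ y := by
    intro y hy
    by_contra h
    exact hy (hbneg y (not_le.mp h))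
  have hbdd : BddBelow B := ⟨0, hlb⟩
  have hL0 : 0 ≤ sInf B := le_csInf hne hlb
  have hlt : ∀ y < sInf B, PropP M y := by
    intro y hy
    by_contra h
    exact absurd (csInf_le hbdd (show y ∈ B from h)) (not_le.mpr hy)
  have hPL := step_P hn heq hpos hL0 hlt
  have hp := hpos (sInf B)
  obtain ⟨y, hyB, hy⟩ := exists_lt_of_csInf_lt hne (show sInf B < sInf B + M (sInf B) by linarith)
  have hLy := csInf_le hbdd hyB
  apply hyB
  intro d hd hdM
  have h1 := hPL (y - sInf B) (by linarith) (by linarith)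
  rw [add_sub_cancel] at h1
  have h2 := hPL (y + d - sInf B) (by linarith) (by linarith)
  rw [add_sub_cancel] at h2
  linarith

/-- For the total, positive-valued `n`-fuse function `Mₙ`: for every `x ≥ 0`
and `1 ≤ i ≤ n-1`, `tᵢ(x)/i ≥ t_{i+1}(x)/(i+1)`. -/
theorem Mn_t_div_antitone (n : ℕ) (hn : 2 ≤ n) (M : ℝ → ℝ)
    (hneg : ∀ x : ℝ, x < 0 → M x = -x)
    (heq : ∀ x : ℝ, 0 ≤ x → M x = tfun M x n / n)
    (hpos : ∀ x : ℝ, 0 < M x)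
    (x : ℝ) (hx : 0 ≤ x) (i : ℕ) (hi1 : 1 ≤ i) (hi2 : i + 1 ≤ n) :
    tfun M x (i + 1) / (i + 1 : ℝ) ≤ tfun M x i / (i : ℝ) := by
  have hP := all_P hn hneg heq hpos
  have h1 := key_le hn heq hpos hx (fun y _ => hP y) i (by omega)
  have ht := tfun_pos hpos x i
  have hi0 : (0 : ℝ) < i := by exact_mod_cast hi1
  rw [div_le_div_iff₀ (by positivity) hi0]
  have h3 : tfun M x (i + 1) = M (x - tfun M x i) := rfl
  by_cases hc : tfun M x i < tfun M x (i + 1)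
  · have h2 := hP (x - tfun M x i) (tfun M x i) ht.le (by rw [← h3]; exact hc)
    rw [sub_add_cancel, ← h3] at h2
    rw [h2] at h1
    linarith
  · nlinarith
end

section
/- Let n ≥ 2 and M = Mₙ the n-fuse function. Every element of F'ₙ = {x + M(x) : x ∈ ℝ} belongs to Fₙ, the set of n-fusible numbers. -/
/-- The set `Fₙ` of `n`-fusible numbers: least subset of ℝ containing `0` and
closed under `gₙ(x₁,…,xₙ) = (x₁+⋯+xₙ+1)/n` whenever the result strictly
exceeds all the arguments. -/
inductive FusibleN (n : ℕ) : ℝ → Prop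
  | zero : FusibleN n 0
  | step (x : Fin n → ℝ) : (∀ j, FusibleN n (x j)) →
      (∀ j, x j < (∑ j, x j + 1) / n) → FusibleN n ((∑ j, x j + 1) / n)

/-- The computation graph of the `n`-fuse algorithm `Mₙ`:
`Mₙ(x) = -x` for `x < 0`; for `x ≥ 0`, `Mₙ(x) = tₙ(x)/n` where `t₀(x) = 1` and
`t_{i+1}(x) = Mₙ(x - tᵢ(x))`. -/
inductive MnGraph (n : ℕ) : ℝ → ℝ → Prop
  | neg (x : ℝ) : x < 0 → MnGraph n x (-x)
  | nonneg (x : ℝ) (t : ℕ → ℝ) : 0 ≤ x → t 0 = 1 →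
      (∀ i < n, MnGraph n (x - t i) (t (i + 1))) → MnGraph n x (t n / n)

def MStar (n : ℕ) (x m : ℝ) : Prop :=
  ∀ y m', MnGraph n y m' → x ≤ y → y < x + m → y + m' = x + m

def MProp (n : ℕ) (x m : ℝ) : Prop :=
  0 < m ∧ MStar n x m ∧ (x < 0 → m = -x) ∧
  (0 ≤ x → ∃ t : ℕ → ℝ, t 0 = 1 ∧ m = t n / n ∧ (∀ j, j < n → t (j + 1) ≤ t j) ∧
    ∀ i, i < n → MStar n (x - t i) (t (i + 1)))

lemma anti_le (n : ℕ) (t : ℕ → ℝ) (h : ∀ j, j < n → t (j + 1) ≤ t j) (i : ℕ) :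
    ∀ k, i ≤ k → k ≤ n → t k ≤ t i := by
  intro k hik
  induction k, hik using Nat.le_induction with
  | base => intro _; exact le_rfl
  | succ k hk ih => intro hkn; exact (h k (by omega)).trans (ih (by omega))

lemma t_anti (n : ℕ) (hn : 2 ≤ n) (x : ℝ) (t : ℕ → ℝ) (hx : 0 ≤ x) (h0 : t 0 = 1)
    (hg : ∀ i, i < n → MnGraph n (x - t i) (t (i + 1)))
    (hP : ∀ i, i < n → MProp n (x - t i) (t (i + 1))) :
    ∀ j, j < n → t (j + 1) ≤ t j := by
  have hn' : (2 : ℝ) ≤ n := by exact_mod_cast hn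
  intro j hj
  obtain ⟨_, _, hneg, hnn⟩ := hP j hj
  rcases lt_or_ge (x - t j) 0 with hv | hv
  · have := hneg hv
    linarith
  obtain ⟨t', h0', hm, ha, hs⟩ := hnn hv
  cases j with
  | zero =>
    have h1 := anti_le n t' ha 0 n (by omega) le_rfl
    rw [hm, h0, div_le_iff₀ (by linarith)]
    linarith
  | succ j =>
    by_contra hlt
    push Not at hlt
    rw [hm, lt_div_iff₀ (by linarith)] at hlt
    have hd : 0 < t (j + 1) := (hP j (by omega)).1
    set d := t (j + 1) with hdd
    have hbig : ∀ i, i ≤ n → d * n < t' i := fun i hi =>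
      lt_of_lt_of_le hlt (anti_le n t' ha i n hi le_rfl)
    have key : ∀ k, k ≤ j + 1 → t' k = t k + k * d := by
      intro k
      induction k with
      | zero => intro _; simp [h0, h0']
      | succ k ih =>
        intro hk
        have e := ih (by omega)
        have hb := hbig (k + 1) (by omega)
        have hkn : ((k : ℝ) + 1) ≤ n := by exact_mod_cast (by omega : k + 1 ≤ n)
        have hkd : ((k : ℝ) + 1) * d ≤ n * d := mul_le_mul_of_nonneg_right hkn hd.le
        have hk0 : 0 ≤ (k : ℝ) * d := by positivity
        have := hs k (by omega) (x - t k) (t (k + 1)) (hg k (by omega))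
          (by rw [e]; linarith) (by rw [e]; linarith)
        push_cast
        rw [e] at this
        linarith
    have e := key (j + 1) le_rfl
    have hb := hbig (j + 1) (by omega)
    have hkn : ((j : ℝ) + 2) ≤ n := by exact_mod_cast (by omega : j + 2 ≤ n)
    have hkd : ((j : ℝ) + 2) * d ≤ n * d := mul_le_mul_of_nonneg_right hkn hd.le
    push_cast at e
    rw [← hdd] at e
    linarith

lemma graph_prop (n : ℕ) (hn : 2 ≤ n) (x m : ℝ) (h : MnGraph n x m) : MProp n x m := by
  have hn' : (2 : ℝ) ≤ n := by exact_mod_cast hn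
  induction h with
  | neg x hx =>
    refine ⟨by linarith, ?_, fun _ => rfl, fun h => absurd hx (not_lt.mpr h)⟩
    intro y m' hy hxy hlt
    cases hy with
    | neg _ _ => ring
    | nonneg _ t h0 _ _ => linarith
  | nonneg x t hx h0 hg hP =>
    have ha := t_anti n hn x t hx h0 hg hP
    have hpos : 0 < t n := by
      have := (hP (n - 1) (by omega)).1
      rwa [Nat.sub_add_cancel (by omega)] at this
    have hnp : (0 : ℝ) < n := by linarith
    refine ⟨by positivity, ?_, fun h => absurd h (not_lt.mpr hx),
      fun _ => ⟨t, h0, rfl, ha, fun i hi => (hP i hi).2.1⟩⟩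
    intro y m' hy hxy hlt
    cases hy with
    | neg _ h => linarith
    | nonneg _ t' hy0 h0' hg' =>
      have hδ : (y - x) * n < t n := by
        rw [← lt_div_iff₀ hnp]; linarith
      have key : ∀ k, k ≤ n → t' k = t k - k * (y - x) := by
        intro k
        induction k with
        | zero => intro _; simp [h0, h0']
        | succ k ih =>
          intro hk
          have e := ih (by omega)
          have hkn : ((k : ℝ) + 1) ≤ n := by exact_mod_cast hk
          have hd : 0 ≤ y - x := by linarith
          have hkd : ((k : ℝ) + 1) * (y - x) ≤ n * (y - x) :=
            mul_le_mul_of_nonneg_right hkn hd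
          have hk0 : 0 ≤ (k : ℝ) * (y - x) := by positivity
          have hle := anti_le n t ha (k + 1) n hk le_rfl
          have := (hP k (by omega)).2.1 (y - t' k) (t' (k + 1)) (hg' k (by omega))
            (by rw [e]; linarith) (by rw [e]; linarith)
          push_cast
          rw [e] at this
          linarith
      rw [key n le_rfl]
      field_simp
      ring

/-- Every element of `F'ₙ = {x + Mₙ(x) : x ∈ ℝ}` is an `n`-fusible number. -/
theorem Mn_image_subset_fusible (n : ℕ) (hn : 2 ≤ n) (x y : ℝ)
    (hxy : MnGraph n x y) : FusibleN n (x + y) := by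
  have hn' : (2 : ℝ) ≤ n := by exact_mod_cast hn
  induction hxy with
  | neg x hx => rw [add_neg_cancel]; exact FusibleN.zero
  | nonneg x t hx h0 hg ih =>
    have ha := t_anti n hn x t hx h0 hg (fun i hi => graph_prop n hn _ _ (hg i hi))
    have hpos := (graph_prop n hn _ _ (MnGraph.nonneg x t hx h0 hg)).1
    have hsum : (∑ j : Fin n, (x - t j + t (j + 1)) + 1) / n = x + t n / n := by
      rw [Fin.sum_univ_eq_sum_range (fun j => x - t j + t (j + 1)) n]
      have : ∀ j ∈ Finset.range n, x - t j + t (j + 1) = x + (t (j + 1) - t j) := by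
        intro j _; ring
      rw [Finset.sum_congr rfl this, Finset.sum_add_distrib, Finset.sum_range_sub, h0]
      have : (n : ℝ) ≠ 0 := by linarith
      simp
      field_simp
      ring
    have := FusibleN.step (n := n) (fun j : Fin n => x - t j + t (j + 1))
      (fun j => ih j j.2) (fun j => by
        rw [hsum]
        have := ha j j.2
        linarith)
    rwa [hsum] at this
end
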